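/- Let G be a simple graph and let C = v_0 v_1 … v_{t-1} v_0 be a non-extendable cycle of length t in G (subscripts modulo t). Suppose v_i and v_j (i ≠ j) are two distinct attachment vertices of C that have a common off-cycle neighbour x, and suppose j ≡ i+2 (mod t). Then there is no index k with k ≢ i (mod t) and k ≢ i+1 (mod t) such that v_{i+1} is adjacent to both v_k and v_{k+1}; in other words, v_{i+1} does not have two consecutive neighbours v_k, v_{k+1} on the path v_{i+2} v_{i+3} … v_i along C. -/

import Mathlib

open SimpleGraph

/-- `G` has a cycle whose vertex set is exactly `s`. -/
def HasCycleOn {V : Type*} (G : SimpleGraph V) (s : Set V) : Prop :=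
  ∃ (a : V) (c : G.Walk a a), c.IsCycle ∧ {x | x ∈ c.support} = s

/-- Consecutive adjacent terms of a sequence form a walk. -/
theorem SimpleGraph.exists_walk_support_eq_map_range {V : Type*} {G : SimpleGraph V}
    (u : ℕ → V) (n : ℕ) (hu : ∀ p < n, G.Adj (u p) (u (p + 1))) :
    ∃ c : G.Walk (u 0) (u n), c.support = (List.range (n + 1)).map u := by
  induction n with
  | zero => exact ⟨.nil, rfl⟩
  | succ n ih =>
    obtain ⟨c, hc⟩ := ih fun p hp => hu p (by omega)
    refine ⟨c.concat (hu n (by omega)), ?_⟩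
    rw [Walk.support_concat, hc, List.range_succ (n := n + 1)]
    simp

/-- An injective closed sequence of at least three adjacent vertices spans a cycle. -/
theorem hasCycleOn_image_Iic {V : Type*} {G : SimpleGraph V} (u : ℕ → V) (n : ℕ) (hn : 2 ≤ n)
    (hu : ∀ p < n, G.Adj (u p) (u (p + 1))) (hclose : G.Adj (u n) (u 0))
    (hinj : Set.InjOn u (Set.Iic n)) : HasCycleOn G (u '' Set.Iic n) := by
  obtain ⟨c, hc⟩ := exists_walk_support_eq_map_range u n hu
  have hpath : c.IsPath := by
    rw [Walk.isPath_def, hc]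
    refine List.Nodup.map_on (fun a ha b hb h => hinj ?_ ?_ h) List.nodup_range
    · simpa [Nat.lt_succ_iff] using ha
    · simpa [Nat.lt_succ_iff] using hb
  have hlen : c.length = n := by
    have := congrArg List.length hc
    simpa using this
  refine ⟨u n, Walk.cons hclose c, (Walk.cons_isCycle_iff _ _).2 ⟨hpath, fun h => ?_⟩, ?_⟩
  · have := hpath.length_eq_one_of_mem_edges (Sym2.eq_swap ▸ h)
    omega
  · ext y
    simp only [Walk.support_cons, hc, List.mem_cons, List.mem_map, List.mem_range, Set.mem_ofPred_eq,
      Set.mem_image, Set.mem_Iic, Nat.lt_succ_iff]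
    constructor
    · rintro (rfl | h)
      · exact ⟨n, le_rfl, rfl⟩
      · exact h
    · exact Or.inr

/-- A cycle `w 0, …, w (s + 2)` in which `w (s + 2)` can be moved between `w m` and `w (m + 1)`
and replaced by a new vertex `x`. -/
theorem hasCycleOn_insert_of_reroute {V : Type*} {G : SimpleGraph V} (w : ℕ → V) (s m : ℕ)
    (hm : m ≤ s) (x : V) (hw : ∀ p ≤ s, G.Adj (w p) (w (p + 1)))
    (hinj : Set.InjOn w (Set.Iic (s + 2))) (hx : x ∉ w '' Set.Iic (s + 2))
    (hx0 : G.Adj x (w 0)) (hxl : G.Adj (w (s + 1)) x)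
    (hm₀ : G.Adj (w m) (w (s + 2))) (hm₁ : G.Adj (w (s + 2)) (w (m + 1))) :
    HasCycleOn G (insert x (w '' Set.Iic (s + 2))) := by
  let σ : ℕ → ℕ := fun p => if p ≤ m then p else if p = m + 1 then s + 2 else p - 1
  let u : ℕ → V
    | 0 => x
    | p + 1 => w (σ p)
  have hσ_le : ∀ p ≤ s + 2, σ p ≤ s + 2 := by
    intro p hp; simp only [σ]; split_ifs <;> omega
  have hσ_inj : ∀ p ≤ s + 2, ∀ q ≤ s + 2, σ p = σ q → p = q := by
    intro p hp q hq; simp only [σ]; split_ifs <;> omega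
  have hσ_surj : ∀ q ≤ s + 2, ∃ p ≤ s + 2, σ p = q := by
    intro q hq
    refine ⟨if q ≤ m then q else if q = s + 2 then m + 1 else q + 1, ?_, ?_⟩
    · split_ifs <;> omega
    · simp only [σ]; split_ifs <;> omega
  have himage : u '' Set.Iic (s + 3) = insert x (w '' Set.Iic (s + 2)) := by
    ext y
    constructor
    · rintro ⟨_ | p, hp, rfl⟩
      · exact Or.inl rfl
      · exact Or.inr ⟨σ p, hσ_le p (Nat.le_of_succ_le_succ hp), rfl⟩
    · rintro (rfl | ⟨q, hq, rfl⟩)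
      · exact ⟨0, Nat.zero_le _, rfl⟩
      · obtain ⟨p, hp, rfl⟩ := hσ_surj q hq
        exact ⟨p + 1, Nat.succ_le_succ hp, rfl⟩
  rw [← himage]
  refine hasCycleOn_image_Iic u (s + 3) (by omega) ?_ ?_ ?_
  · rintro (_ | p) hp
    · simpa [u, σ] using hx0
    · change G.Adj (w (σ p)) (w (σ (p + 1)))
      rcases lt_trichotomy p m with h | rfl | h
      · rw [show σ p = p by grind, show σ (p + 1) = p + 1 by grind]
        exact hw p (by omega)
      · rw [show σ p = p by grind, show σ (p + 1) = s + 2 by grind]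
        exact hm₀
      · rcases eq_or_ne p (m + 1) with rfl | h'
        · rw [show σ (m + 1) = s + 2 by grind, show σ (m + 1 + 1) = m + 1 by grind]
          exact hm₁
        · obtain ⟨r, rfl⟩ : ∃ r, p = r + 1 := ⟨p - 1, by omega⟩
          rw [show σ (r + 1) = r by grind, show σ (r + 1 + 1) = r + 1 by grind]
          exact hw r (by omega)
  · change G.Adj (w (σ (s + 2))) x
    rw [show σ (s + 2) = s + 1 by grind]
    exact hxl
  · rintro (_ | p) hp (_ | q) hq h
    · rfl
    · exact (hx ⟨σ q, hσ_le q (Nat.le_of_succ_le_succ hq), h.symm⟩).elim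
    · exact (hx ⟨σ p, hσ_le p (Nat.le_of_succ_le_succ hp), h⟩).elim
    · have hp' := Nat.le_of_succ_le_succ hp
      have hq' := Nat.le_of_succ_le_succ hq
      rw [hσ_inj p hp' q hq' (hinj (hσ_le p hp') (hσ_le q hq') h)]

/-- Lemma 1(4): if `C = v 0, v 1, …, v (t-1), v 0` is a non-extendable cycle in `G`,
`v i`, `v j` are distinct attachment vertices with a common off-cycle neighbour `x`,
and `j = i + 2`, then `v (i+1)` has no two consecutive neighbours `v k`, `v (k+1)`
on the path `v (i+2), v (i+3), …, v i` along `C`. -/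
theorem nonextendable_common_offcycle_neighbour_no_consecutive_neighbours
    {V : Type*} (G : SimpleGraph V) (t : ℕ) (ht : 3 ≤ t)
    (v : ZMod t → V) (hinj : Function.Injective v)
    (hadj : ∀ z : ZMod t, G.Adj (v z) (v (z + 1)))
    (hnonext : ¬∃ x ∉ Set.range v, HasCycleOn G (insert x (Set.range v)))
    (i j : ZMod t) (hij : i ≠ j) (x : V) (hxoff : x ∉ Set.range v)
    (hxi : G.Adj (v i) x) (hxj : G.Adj (v j) x)
    (hj : j = i + 2) :
    ¬∃ k : ZMod t, k ≠ i ∧ k ≠ i + 1 ∧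
      G.Adj (v (i + 1)) (v k) ∧ G.Adj (v (i + 1)) (v (k + 1)) := by
  rintro ⟨k, hki, hki1, hk, hk'⟩
  subst hj
  obtain ⟨s, rfl⟩ : ∃ s, t = s + 3 := ⟨t - 3, by omega⟩
  have hzero : (s : ZMod (s + 3)) + 3 = 0 := by exact_mod_cast ZMod.natCast_self (s + 3)
  let w : ℕ → V := fun p => v (i + 2 + p)
  have hval : ∀ z : ZMod (s + 3), ∃ m ≤ s + 2, i + 2 + (m : ZMod (s + 3)) = z := fun z =>
    ⟨(z - (i + 2)).val, Nat.lt_succ_iff.1 (ZMod.val_lt _), by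
      rw [ZMod.natCast_zmod_val]; ring⟩
  have hlast : i + 2 + ((s + 1 : ℕ) : ZMod (s + 3)) = i := by
    push_cast; linear_combination hzero
  have hmid : i + 2 + ((s + 2 : ℕ) : ZMod (s + 3)) = i + 1 := by
    push_cast; linear_combination hzero
  have hstep : ∀ p : ℕ, i + 2 + ((p + 1 : ℕ) : ZMod (s + 3)) = i + 2 + p + 1 := by
    intro p; push_cast; ring
  have hrange : w '' Set.Iic (s + 2) = Set.range v := by
    ext y
    constructor
    · rintro ⟨p, -, rfl⟩
      exact ⟨_, rfl⟩
    · rintro ⟨z, rfl⟩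
      obtain ⟨m, hm, rfl⟩ := hval z
      exact ⟨m, hm, rfl⟩
  obtain ⟨m, hm, rfl⟩ := hval k
  have hms : m ≤ s := by
    have h₁ : m ≠ s + 1 := fun h => hki (h ▸ hlast)
    have h₂ : m ≠ s + 2 := fun h => hki1 (h ▸ hmid)
    omega
  refine hnonext ⟨x, hxoff, ?_⟩
  rw [← hrange]
  refine hasCycleOn_insert_of_reroute w s m hms x ?_ ?_ (hrange ▸ hxoff) ?_ ?_ ?_ ?_
  · intro p _
    simpa only [w, hstep] using hadj (i + 2 + p)
  · intro p hp q hq h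
    have hcast := add_left_cancel (hinj h)
    rw [ZMod.natCast_eq_natCast_iff'] at hcast
    rwa [Nat.mod_eq_of_lt (Nat.lt_succ_iff.2 hp), Nat.mod_eq_of_lt (Nat.lt_succ_iff.2 hq)] at hcast
  · simpa [w] using hxj.symm
  · simpa only [w, hlast] using hxi
  · simpa only [w, hmid] using hk.symm
  · simpa only [w, hmid, hstep] using hk'
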